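/- Among primes p < 2000, p = 67 is the unique prime with the following property: there is no irrational real ξ such that the infinite simple continued fraction expansions of both ξ and p·ξ have all partial quotients equal to 1 or 2 from some index onward. -/

import Mathlib

/-- The `k`-th partial quotient of the simple continued fraction expansion of `ξ`
(computed via the Gauss map; for irrational `ξ` this agrees with the unique
infinite simple continued fraction expansion `ξ = [a₀; a₁, a₂, …]`). -/
noncomputable def cfTerm : ℕ → ℝ → ℤ
  | 0, ξ => ⌊ξ⌋
  | k + 1, ξ => cfTerm k (ξ - ⌊ξ⌋)⁻¹

/-- The continued fraction expansion of `ξ` eventually consists of only `1`'s and `2`'s. -/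
def EventuallyOnesAndTwos (ξ : ℝ) : Prop :=
  ∃ N : ℕ, ∀ i ≥ N, cfTerm i ξ = 1 ∨ cfTerm i ξ = 2

/-- The integer matrix `(a b; c d)` with nonnegative entries, thought of as the Möbius
transformation `x ↦ (a x + b) / (c x + d)`. -/
structure NatMat where
  a : ℕ
  b : ℕ
  c : ℕ
  d : ℕ
deriving DecidableEq

namespace NatMat

/-- `M.Rel x y` says that `y` is the image of `x` under the Möbius transformation `M`. -/
def Rel (M : NatMat) (x y : ℝ) : Prop :=
  M.a * x + M.b = y * (M.c * x + M.d)

/-- Right multiplication by `(q 1; 1 0)`: read the partial quotient `q`. -/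
def read (M : NatMat) (q : ℕ) : NatMat :=
  ⟨M.a * q + M.b, M.a, M.c * q + M.d, M.c⟩

/-- Read a list of partial quotients. -/
def readWord (M : NatMat) (l : List ℕ) : NatMat :=
  l.foldl read M

/-- Write as many partial quotients as `M` determines, at most `k`; return them and the rest. -/
def emit : ℕ → NatMat → List ℕ × NatMat
  | 0, M => ([], M)
  | k + 1, M =>
    if 0 < M.c ∧ 0 < M.d ∧ M.a / M.c = M.b / M.d then
      (M.a / M.c :: (emit k ⟨M.c, M.d, M.a % M.c, M.b % M.d⟩).1,
        (emit k ⟨M.c, M.d, M.a % M.c, M.b % M.d⟩).2)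
    else ([], M)

end NatMat

/-- The word over `{1, 2}` given by the binary digits of `n` below the leading one. -/
def wordOfCode : ℕ → ℕ → List ℕ
  | 0, _ => []
  | k + 1, n => if n ≤ 1 then [] else (n % 2 + 1) :: wordOfCode k (n / 2)

/-- All entries of the list are `1` or `2`. -/
def OnesAndTwos (l : List ℕ) : Prop :=
  ∀ q ∈ l, q = 1 ∨ q = 2

instance (l : List ℕ) : Decidable (OnesAndTwos l) :=
  inferInstanceAs (Decidable (∀ q ∈ l, q = 1 ∨ q = 2))

/-- A certificate that `p` maps `[0; j, w, w, w, …]` to a number with eventually periodic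
expansion whose period is a word over `{1, 2}`. -/
def IsWitness (p j : ℕ) (w : List ℕ) : Prop :=
  let s := ((fun M : NatMat => M.readWord w)^[16] ⟨p, 0, j, 1⟩).emit 1000
  let t := (s.2.readWord w).emit 1000
  1 ≤ j ∧ w ≠ [] ∧ OnesAndTwos w ∧ t.1 ≠ [] ∧ OnesAndTwos t.1 ∧ t.2 = s.2 ∧
    (∀ q ∈ s.1.tail, 1 ≤ q) ∧ 0 < s.2.a + s.2.b ∧ 0 < s.2.c + s.2.d

instance (p j : ℕ) (w : List ℕ) : Decidable (IsWitness p j w) := by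
  unfold IsWitness
  infer_instance

/-- Triples `(p, j, n)` where `n` codes a word `w` such that `IsWitness p j w`. -/
def witnessTable : List (ℕ × ℕ × ℕ) :=
  [(2, 1, 3), (3, 2, 5), (5, 3, 2), (7, 4, 3), (11, 4, 2), (13, 5, 6), (17, 7, 3), (19, 5, 2),
   (23, 6, 3), (29, 6, 2), (31, 13, 2), (37, 16, 6), (41, 7, 2), (43, 9, 25), (47, 8, 3),
   (53, 33, 28), (59, 26, 2), (61, 18, 2), (71, 9, 2), (73, 33, 3), (79, 30, 2), (83, 14, 6),
   (89, 10, 2), (97, 15, 3), (101, 23, 2), (103, 39, 3), (107, 45, 5), (109, 11, 2),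
   (113, 52, 3), (127, 17, 3), (131, 12, 2), (137, 32, 3), (139, 64, 2), (149, 41, 2),
   (151, 28, 2), (157, 73, 6), (163, 38, 422), (167, 14, 3), (173, 122, 50), (179, 75, 2),
   (181, 14, 2), (191, 89, 2), (193, 53, 3), (197, 137, 61), (199, 62, 2), (211, 33, 2),
   (223, 16, 3), (227, 51, 6), (229, 82, 2), (233, 86, 3), (239, 16, 2), (241, 52, 2),
   (251, 118, 2), (257, 61, 3), (263, 111, 3), (269, 72, 2), (271, 17, 2), (277, 74, 5),
   (281, 38, 2), (283, 52, 62), (293, 105, 1736), (307, 289, 76), (311, 59, 2), (313, 121, 3),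
   (317, 114, 517), (331, 117, 2), (337, 27, 3), (347, 48, 5), (349, 144, 2), (353, 168, 3),
   (359, 106, 2), (367, 80, 3), (373, 132, 6), (379, 20, 2), (383, 138, 3), (389, 152, 2),
   (397, 21, 6), (401, 112, 2), (409, 130, 2), (419, 21, 2), (421, 111, 2), (431, 91, 2),
   (433, 207, 3), (439, 70, 2), (443, 172, 6), (449, 166, 2), (457, 81, 3), (461, 22, 2),
   (463, 204, 3), (467, 167, 6), (479, 229, 2), (487, 92, 3), (491, 74, 2), (499, 225, 2),
   (503, 158, 3), (509, 122, 2), (521, 100, 2), (523, 28, 28), (541, 173, 2), (547, 88, 59),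
   (557, 36, 55), (563, 61, 5), (569, 233, 2), (571, 274, 2), (577, 35, 3), (587, 273, 5),
   (593, 143, 3), (599, 25, 2), (601, 137, 2), (607, 195, 3), (613, 295, 6), (617, 297, 3),
   (619, 243, 2), (631, 110, 2), (641, 279, 2), (643, 28, 55), (647, 37, 3), (653, 236, 301),
   (659, 201, 2), (661, 58, 2), (673, 284, 3), (677, 414, 52), (683, 38, 6), (691, 222, 2),
   (701, 27, 2), (709, 171, 2), (719, 330, 2), (727, 28, 3), (733, 128, 6), (739, 119, 2),
   (743, 103, 3), (751, 211, 2), (757, 244, 6), (761, 92, 2), (769, 339, 2), (773, 611, 468),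
   (787, 203, 47), (797, 486, 19), (809, 343, 2), (811, 29, 2), (821, 213, 2), (823, 285, 3),
   (827, 263, 6), (829, 96, 2), (839, 342, 2), (853, 138, 6), (857, 164, 3), (859, 277, 2),
   (863, 252, 3), (877, 247, 6), (881, 327, 2), (883, 726, 19), (887, 203, 3), (907, 187, 37),
   (911, 68, 2), (919, 317, 2), (929, 31, 2), (937, 82, 3), (941, 228, 2), (947, 290, 5),
   (953, 462, 3), (967, 45, 3), (971, 174, 2), (977, 213, 3), (983, 451, 3), (991, 32, 2),
   (997, 344, 6), (1009, 383, 2), (1013, 62, 691), (1019, 494, 2), (1021, 458, 2),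
   (1031, 107, 2), (1033, 405, 3), (1039, 287, 2), (1049, 326, 2), (1051, 73, 2), (1061, 460, 2),
   (1063, 123, 3), (1069, 276, 2), (1087, 34, 3), (1091, 212, 2), (1093, 41, 5), (1097, 408, 3),
   (1103, 323, 3), (1109, 407, 2), (1117, 463, 5), (1123, 575, 24224), (1129, 328, 2),
   (1151, 559, 2), (1153, 199, 3), (1163, 476, 6), (1171, 114, 2), (1181, 534, 2),
   (1187, 413, 6), (1193, 308, 3), (1201, 78, 2), (1213, 295, 5), (1217, 592, 3), (1223, 36, 3),
   (1229, 485, 2), (1231, 270, 2), (1237, 342, 6), (1249, 405, 2), (1259, 36, 2),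
   (1277, 760, 25), (1279, 600, 2), (1283, 292, 6), (1289, 157, 2), (1291, 628, 2),
   (1297, 211, 3), (1301, 268, 2), (1303, 552, 3), (1307, 156, 5), (1319, 400, 2),
   (1321, 453, 2), (1327, 256, 3), (1361, 83, 2), (1367, 38, 3), (1373, 202, 70), (1381, 610, 2),
   (1399, 240, 2), (1409, 125, 2), (1423, 402, 3), (1427, 422, 5), (1429, 547, 2),
   (1433, 585, 3), (1439, 701, 2), (1447, 259, 3), (1451, 283, 2), (1453, 618, 6),
   (1459, 167, 2), (1471, 478, 2), (1481, 39, 2), (1483, 144, 19), (1487, 160, 3),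
   (1489, 681, 2), (1493, 486, 641), (1499, 209, 2), (1511, 346, 2), (1523, 100, 5),
   (1531, 88, 2), (1543, 607, 3), (1549, 530, 2), (1553, 190, 3), (1559, 40, 2), (1567, 57, 3),
   (1571, 568, 2), (1579, 683, 2), (1583, 233, 3), (1597, 41, 6), (1601, 606, 2), (1607, 151, 3),
   (1609, 636, 2), (1613, 742, 22), (1619, 765, 2), (1621, 176, 2), (1627, 449, 206),
   (1637, 133, 47), (1657, 344, 3), (1663, 569, 3), (1667, 707, 6), (1669, 136, 2),
   (1693, 194, 6), (1697, 110, 3), (1699, 230, 2), (1709, 601, 2), (1721, 42, 2),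
   (1723, 523, 76), (1733, 406, 25), (1741, 321, 2), (1747, 300, 47), (1753, 680, 3),
   (1759, 859, 2), (1777, 290, 3), (1783, 159, 3), (1787, 265, 6), (1789, 236, 2),
   (1801, 427, 2), (1811, 186, 2), (1823, 856, 3), (1831, 779, 2), (1847, 44, 3), (1861, 364, 2),
   (1867, 478, 265), (1871, 672, 2), (1873, 545, 3), (1877, 1433, 70), (1879, 423, 2),
   (1889, 824, 2), (1901, 98, 2), (1907, 514, 6), (1913, 618, 3), (1931, 944, 2), (1933, 45, 6),
   (1949, 789, 2), (1951, 147, 2), (1973, 67, 25), (1979, 45, 2), (1987, 339, 322),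
   (1993, 488, 3), (1997, 820, 148), (1999, 950, 2)]

theorem isWitness_of_mem_witnessTable :
    ∀ t ∈ witnessTable, IsWitness t.1 t.2.1 (wordOfCode 30 t.2.2) := by
  decide +kernel

theorem exists_mem_witnessTable {p : ℕ} (hp : p.Prime) (hlt : p < 2000) (h67 : p ≠ 67) :
    ∃ t ∈ witnessTable, t.1 = p := by
  have key : (List.range 2000).all (fun p => p.ble 1 ||
      [2, 3, 5, 7, 11, 13, 17, 19, 23, 29, 31, 37, 41, 43].any
        (fun q => (q + 1).ble p && (p % q).beq 0) ||
      p.beq 67 || witnessTable.any (fun t => t.1.beq p)) = true := by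
    decide +kernel
  have := List.all_eq_true.mp key p (List.mem_range.mpr hlt)
  simp only [Bool.or_eq_true, Bool.and_eq_true, List.any_eq_true, Nat.ble_eq, Nat.beq_eq] at this
  rcases this with ((h | ⟨q, hq, hqp, hdvd⟩) | h) | h
  · exact absurd hp.two_le (by omega)
  · rcases (Nat.dvd_prime hp).mp (Nat.dvd_of_mod_eq_zero hdvd) with rfl | rfl
    · simp at hq
    · exact absurd hqp (by omega)
  · exact absurd h h67
  · exact h

section ContinuedFraction

theorem cfTerm_succ_natCast_add_inv (a : ℕ) {y : ℝ} (hy : 1 < y) (i : ℕ) :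
    cfTerm (i + 1) (a + y⁻¹) = cfTerm i y := by
  have hfloor : ⌊(a : ℝ) + y⁻¹⌋ = a := by
    rw [Int.floor_eq_iff]
    have h0 : 0 < y⁻¹ := by positivity
    have h1 : y⁻¹ < 1 := inv_lt_one_of_one_lt₀ hy
    constructor <;> push_cast <;> linarith
  simp [cfTerm, hfloor]

theorem cfTerm_zero_natCast_add_inv (a : ℕ) {y : ℝ} (hy : 1 < y) :
    cfTerm 0 (a + y⁻¹) = a := by
  rw [cfTerm, Int.floor_eq_iff]
  have h0 : 0 < y⁻¹ := by positivity
  have h1 : y⁻¹ < 1 := inv_lt_one_of_one_lt₀ hy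
  constructor <;> push_cast <;> linarith

theorem EventuallyOnesAndTwos.natCast_add_inv (a : ℕ) {y : ℝ} (hy : 1 < y)
    (h : EventuallyOnesAndTwos y) : EventuallyOnesAndTwos (a + y⁻¹) := by
  obtain ⟨N, hN⟩ := h
  refine ⟨N + 1, fun i hi => ?_⟩
  obtain ⟨k, rfl⟩ : ∃ k, i = k + 1 := ⟨i - 1, by omega⟩
  rw [cfTerm_succ_natCast_add_inv a hy]
  exact hN k (by omega)

theorem cfTerm_zero_right (i : ℕ) : cfTerm i 0 = 0 := by
  induction i with
  | zero => simp [cfTerm]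
  | succ k ih => simpa [cfTerm] using ih

theorem exists_cfTerm_ratCast_eq_zero (q : ℚ) : ∃ N, ∀ i ≥ N, cfTerm i (q : ℝ) = 0 := by
  induction hn : q.den using Nat.strong_induction_on generalizing q with
  | _ n ih =>
    have hcast : ((q : ℝ) - ⌊(q : ℝ)⌋)⁻¹ = (((Int.fract q)⁻¹ : ℚ) : ℝ) := by
      rw [Rat.floor_cast, ← Int.self_sub_floor]; push_cast; rfl
    have hstep : ∃ N, ∀ i ≥ N, cfTerm i (((Int.fract q)⁻¹ : ℚ) : ℝ) = 0 := by
      rcases (Int.fract_nonneg q).eq_or_lt with h0 | h0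
      · exact ⟨0, fun i _ => by rw [← h0]; simpa using cfTerm_zero_right i⟩
      · refine ih _ ?_ _ rfl
        have hnum : 0 < (Int.fract q).num := Rat.num_pos.mpr h0
        have hlt : (Int.fract q).num < (Int.fract q).den :=
          Rat.num_lt_denom_iff.mpr (Int.fract_lt_one q)
        have hden : (Int.fract q).den = q.den := by
          rw [Int.fract]; exact_mod_cast Rat.sub_intCast_den q ⌊q⌋
        rw [Rat.den_inv_of_ne_zero h0.ne']
        omega
    obtain ⟨N, hN⟩ := hstep
    refine ⟨N + 1, fun i hi => ?_⟩
    obtain ⟨k, rfl⟩ : ∃ k, i = k + 1 := ⟨i - 1, by omega⟩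
    rw [cfTerm, hcast]
    exact hN k (by omega)

theorem EventuallyOnesAndTwos.irrational {x : ℝ} (h : EventuallyOnesAndTwos x) :
    Irrational x := by
  rintro ⟨q, rfl⟩
  obtain ⟨N, hN⟩ := h
  obtain ⟨K, hK⟩ := exists_cfTerm_ratCast_eq_zero q
  have h1 := hN (max N K) (le_max_left _ _)
  rw [hK _ (le_max_right _ _)] at h1
  omega

/-- The value `a₀ + 1 / (a₁ + 1 / (⋯ + 1 / x))`. -/
noncomputable def cfEval : List ℕ → ℝ → ℝ
  | [], x => x
  | a :: l, x => a + (cfEval l x)⁻¹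

theorem cfEval_pos (l : List ℕ) {x : ℝ} (hx : 0 < x) : 0 < cfEval l x := by
  induction l with
  | nil => exact hx
  | cons a l ih => rw [cfEval]; positivity

theorem one_lt_cfEval {l : List ℕ} (hl : ∀ q ∈ l, 1 ≤ q) (hne : l ≠ []) {x : ℝ} (hx : 0 < x) :
    1 < cfEval l x := by
  cases l with
  | nil => exact absurd rfl hne
  | cons a l =>
    have h0 : 0 < (cfEval l x)⁻¹ := inv_pos.mpr (cfEval_pos l hx)
    have h1 : (1 : ℝ) ≤ a := by exact_mod_cast hl a (by simp)
    rw [cfEval]; linarith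

theorem EventuallyOnesAndTwos.cfEval {l : List ℕ} (hl : ∀ q ∈ l.tail, 1 ≤ q) {y : ℝ} (hy : 1 < y)
    (h : EventuallyOnesAndTwos y) : EventuallyOnesAndTwos (cfEval l y) := by
  induction l with
  | nil => exact h
  | cons a l ih =>
    refine EventuallyOnesAndTwos.natCast_add_inv a ?_ (ih fun q hq => hl q (List.mem_of_mem_tail hq))
    rcases eq_or_ne l [] with rfl | hne
    · exact hy
    · exact one_lt_cfEval hl hne (by linarith)

theorem OnesAndTwos.one_le {l : List ℕ} (hl : OnesAndTwos l) : ∀ q ∈ l, 1 ≤ q := fun q hq => by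
  rcases hl q hq with h | h <;> omega

theorem eventuallyOnesAndTwos_of_eq_cfEval {l : List ℕ} (hl : OnesAndTwos l) (hne : l ≠ [])
    {x : ℝ} (hx : 0 < x) (hfix : cfEval l x = x) : EventuallyOnesAndTwos x := by
  suffices H : ∀ i m, OnesAndTwos m → m ≠ [] →
      cfTerm i (cfEval m x) = 1 ∨ cfTerm i (cfEval m x) = 2 from
    ⟨0, fun i _ => by simpa only [hfix] using H i l hl hne⟩
  intro i
  induction i with
  | zero =>
    intro m hm hm0
    obtain ⟨a, m, rfl⟩ := List.exists_cons_of_ne_nil hm0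
    have h1 : 1 < cfEval m x := by
      rcases eq_or_ne m [] with rfl | h
      · rw [cfEval, ← hfix]; exact one_lt_cfEval hl.one_le hne hx
      · exact one_lt_cfEval (fun q hq => hm.one_le q (by simp [hq])) h hx
    rw [cfEval, cfTerm_zero_natCast_add_inv a h1]
    exact_mod_cast hm a (by simp)
  | succ i ih =>
    intro m hm hm0
    obtain ⟨a, m, rfl⟩ := List.exists_cons_of_ne_nil hm0
    rcases eq_or_ne m [] with rfl | h
    · have h1 := one_lt_cfEval hl.one_le hne hx
      rw [hfix] at h1
      rw [cfEval, cfEval, cfTerm_succ_natCast_add_inv a h1]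
      simpa only [hfix] using ih l hl hne
    · have hm' : OnesAndTwos m := fun q hq => hm q (by simp [hq])
      rw [cfEval, cfTerm_succ_natCast_add_inv a (one_lt_cfEval hm'.one_le h hx)]
      exact ih m hm' h

theorem exists_cfEval_eq_self {l : List ℕ} (hl : OnesAndTwos l) :
    ∃ x : ℝ, 0 < x ∧ cfEval l x = x := by
  have hmaps : Set.MapsTo (cfEval l) (Set.Icc 1 3) (Set.Icc 1 3) := by
    induction l with
    | nil => exact fun x hx => hx
    | cons a l ih =>
      intro x hx
      obtain ⟨h1, -⟩ := ih (fun q hq => hl q (by simp [hq])) hx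
      have h2 : (cfEval l x)⁻¹ ≤ 1 := inv_le_one_of_one_le₀ h1
      have h3 : 0 < (cfEval l x)⁻¹ := by positivity
      rw [cfEval]
      rcases hl a (by simp) with rfl | rfl <;> constructor <;> push_cast <;> linarith
  have hcont : ContinuousOn (cfEval l) (Set.Icc 1 3) := by
    clear hmaps hl
    induction l with
    | nil => exact continuousOn_id
    | cons a l ih =>
      exact continuousOn_const.add
        (ih.inv₀ fun x hx => (cfEval_pos l (by linarith [hx.1] : (0 : ℝ) < x)).ne')
  obtain ⟨x, hx, hfix⟩ := exists_mem_Icc_isFixedPt_of_mapsTo hcont (by norm_num) hmaps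
  exact ⟨x, by linarith [hx.1], hfix⟩

end ContinuedFraction

namespace NatMat

theorem rel_read {M : NatMat} {q : ℕ} {x y : ℝ} (hx : 0 < x) (h : (M.read q).Rel x y) :
    M.Rel (q + x⁻¹) y := by
  simp only [Rel, read] at h ⊢
  push_cast at h
  field_simp
  linarith

theorem rel_readWord {l : List ℕ} {M : NatMat} {x y : ℝ} (hx : 0 < x)
    (h : (M.readWord l).Rel x y) : M.Rel (cfEval l x) y := by
  induction l generalizing M with
  | nil => exact h
  | cons q l ih => exact rel_read (cfEval_pos l hx) (ih h)

theorem rel_iterate_readWord {l : List ℕ} {x y : ℝ} (hx : 0 < x) (hfix : cfEval l x = x) (k : ℕ)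
    {M : NatMat} (h : ((fun M : NatMat => M.readWord l)^[k] M).Rel x y) : M.Rel x y := by
  induction k generalizing M with
  | zero => exact h
  | succ k ih => rw [← hfix]; exact rel_readWord hx (ih h)

theorem rel_emit {k : ℕ} {M : NatMat} {x y : ℝ} (hy : 0 < y) (h : (emit k M).2.Rel x y) :
    M.Rel x (cfEval (emit k M).1 y) := by
  induction k generalizing M with
  | zero => exact h
  | succ k ih =>
    rw [emit] at h ⊢
    split_ifs at h ⊢ with hc
    · have key := ih h
      have hpos := cfEval_pos (emit k ⟨M.c, M.d, M.a % M.c, M.b % M.d⟩).1 hy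
      simp only [cfEval]
      set z := cfEval (emit k ⟨M.c, M.d, M.a % M.c, M.b % M.d⟩).1 y
      have ha : ((M.c * (M.a / M.c) + M.a % M.c : ℕ) : ℝ) = M.a := by rw [Nat.div_add_mod]
      have hb : ((M.d * (M.a / M.c) + M.b % M.d : ℕ) : ℝ) = M.b := by
        rw [hc.2.2, Nat.div_add_mod]
      push_cast at ha hb
      simp only [Rel] at key ⊢
      rw [← ha, ← hb]
      field_simp
      linear_combination -key
    · exact h

theorem Rel.unique {M : NatMat} {x y z : ℝ} (hx : 0 < x) (hM : 0 < M.c + M.d) (hy : M.Rel x y)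
    (hz : M.Rel x z) : y = z := by
  have hpos : 0 < (M.c : ℝ) * x + M.d := by
    rcases Nat.eq_zero_or_pos M.c with h | h
    · have : 0 < (M.d : ℝ) := by exact_mod_cast (by omega : 0 < M.d)
      positivity
    · positivity
  exact mul_right_cancel₀ hpos.ne' (hy.symm.trans hz)

theorem exists_rel {M : NatMat} {x : ℝ} (hx : 0 < x) (hab : 0 < M.a + M.b)
    (hcd : 0 < M.c + M.d) : ∃ y, 0 < y ∧ M.Rel x y := by
  have hpos : ∀ m n : ℕ, 0 < m + n → 0 < (m : ℝ) * x + n := fun m n h => by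
    rcases Nat.eq_zero_or_pos m with h | h
    · have : 0 < (n : ℝ) := by exact_mod_cast (by omega : 0 < n)
      positivity
    · positivity
  exact ⟨_, div_pos (hpos _ _ hab) (hpos _ _ hcd), (div_mul_cancel₀ _ (hpos _ _ hcd).ne').symm⟩

end NatMat

theorem IsWitness.exists_irrational {p j : ℕ} {w : List ℕ} (h : IsWitness p j w) :
    ∃ ξ : ℝ, Irrational ξ ∧ EventuallyOnesAndTwos ξ ∧ EventuallyOnesAndTwos ((p : ℝ) * ξ) := by
  obtain ⟨hj, hw0, hw, ht0, ht, hts, hs, hab, hcd⟩ := h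
  set s := ((fun M : NatMat => M.readWord w)^[16] ⟨p, 0, j, 1⟩).emit 1000
  obtain ⟨x, hx, hfix⟩ := exists_cfEval_eq_self hw
  obtain ⟨y, hy, hxy⟩ := NatMat.exists_rel hx hab hcd
  have hyfix : cfEval ((s.2.readWord w).emit 1000).1 y = y := by
    refine NatMat.Rel.unique hx hcd ?_ hxy
    rw [← hts] at hxy
    simpa only [hfix] using NatMat.rel_readWord hx (NatMat.rel_emit hy hxy)
  have hy1 : 1 < y := by
    rw [← hyfix]; exact one_lt_cfEval ht.one_le ht0 hy
  have hx1 : 1 < x := by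
    rw [← hfix]; exact one_lt_cfEval hw.one_le hw0 hx
  have hprod : (p : ℝ) * cfEval [0, j] x = cfEval s.1 y := by
    have h1 := NatMat.rel_iterate_readWord hx hfix 16 (NatMat.rel_emit hy hxy)
    have hj0 : (0 : ℝ) < j := by exact_mod_cast hj
    simp only [NatMat.Rel] at h1
    simp only [cfEval]
    push_cast at h1 ⊢
    field_simp
    linarith
  have hξ : EventuallyOnesAndTwos (cfEval [0, j] x) :=
    .cfEval (by simpa using hj) hx1 (eventuallyOnesAndTwos_of_eq_cfEval hw hw0 hx hfix)
  refine ⟨_, hξ.irrational, hξ, ?_⟩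
  rw [hprod]
  exact .cfEval hs hy1 (eventuallyOnesAndTwos_of_eq_cfEval ht ht0 hy hyfix)

namespace NatMat

/-- Subtractive transducer on Möbius transformations. Numbers are expanded by the map `x ↦ x - 1`
for `x > 1` and `x ↦ x / (1 - x)` for `x < 1`; `xr`, `xl` (resp. `yr`, `yl`) are lower bounds for
the length of the current run of either letter in the input (resp. output). The value is `true` if
some run of `k` steps has no three consecutive equal letters in the input or the output. -/
def alive : ℕ → NatMat → ℕ → ℕ → ℕ → ℕ → Bool
  | 0, _, _, _, _, _ => true
  | k + 1, ⟨a, b, c, d⟩, xr, xl, yr, yl =>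
    bif c.ble a && d.ble b then
      yr.ble 1 && alive k ⟨a - c, b - d, c, d⟩ xr xl (yr + 1) 0
    else bif a.ble c && b.ble d then
      yl.ble 1 && alive k ⟨a, b, c - a, d - b⟩ xr xl 0 (yl + 1)
    else
      (xr.ble 1 && alive k ⟨a, a + b, c, c + d⟩ (xr + 1) 0 yr yl) ||
        (xl.ble 1 && alive k ⟨a + b, b, c + d, d⟩ 0 (xl + 1) yr yl)

end NatMat

theorem not_alive_sixtySeven {b c i : ℕ} (hc : c < 67) (hb : b < 67 - c) (hi : i < 67 - b - c)
    (h : (67 + b * c) % (c + 1 + i) = 0) :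
    NatMat.alive 50 ⟨c + 1 + i, b, c, (67 + b * c) / (c + 1 + i)⟩ 0 0 0 0 = false := by
  have key : (List.range 67).all (fun c => (List.range (67 - c)).all fun b =>
      (List.range (67 - b - c)).all fun i => bif ((67 + b * c) % (c + 1 + i)).beq 0 then
        !NatMat.alive 50 ⟨c + 1 + i, b, c, (67 + b * c) / (c + 1 + i)⟩ 0 0 0 0 else true) = true := by
    decide +kernel
  simp only [List.all_eq_true, List.mem_range] at key
  simpa [h] using key c hc b hb i hi

section SubtractiveExpansion

/-- One step of the subtractive continued fraction algorithm on positive reals. -/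
noncomputable def subStep (x : ℝ) : ℝ :=
  if 1 < x then x - 1 else (x⁻¹ - 1)⁻¹

theorem subStep_of_one_lt {x : ℝ} (hx : 1 < x) : subStep x = x - 1 := if_pos hx

theorem subStep_of_lt_one {x : ℝ} (hx : x < 1) : subStep x = (x⁻¹ - 1)⁻¹ := if_neg hx.not_gt

theorem Irrational.lt_or_gt_one {x : ℝ} (h : Irrational x) : x < 1 ∨ 1 < x :=
  lt_or_gt_of_ne h.ne_one

theorem irrational_subStep {x : ℝ} (h : Irrational x) : Irrational (subStep x) := by
  rcases h.lt_or_gt_one with hx | hx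
  · rw [subStep_of_lt_one hx]
    simpa using (h.inv.sub_natCast 1).inv
  · rw [subStep_of_one_lt hx]
    simpa using h.sub_natCast 1

theorem subStep_pos {x : ℝ} (h : Irrational x) (h0 : 0 < x) : 0 < subStep x := by
  rcases h.lt_or_gt_one with hx | hx
  · rw [subStep_of_lt_one hx]
    exact inv_pos.mpr (sub_pos.mpr (one_lt_inv₀ h0 |>.mpr hx))
  · rw [subStep_of_one_lt hx]
    linarith

theorem subStep_inv {x : ℝ} (h : Irrational x) (h0 : 0 < x) : subStep x⁻¹ = (subStep x)⁻¹ := by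
  rcases h.lt_or_gt_one with hx | hx
  · rw [subStep_of_lt_one hx, subStep_of_one_lt ((one_lt_inv₀ h0).mpr hx), inv_inv]
  · rw [subStep_of_one_lt hx, subStep_of_lt_one (inv_lt_one_of_one_lt₀ hx), inv_inv]

theorem iterate_subStep_spec {x : ℝ} (h : Irrational x) (h0 : 0 < x) (n : ℕ) :
    Irrational (subStep^[n] x) ∧ 0 < subStep^[n] x ∧ subStep^[n] x⁻¹ = (subStep^[n] x)⁻¹ := by
  induction n with
  | zero => exact ⟨h, h0, rfl⟩
  | succ n ih =>
    obtain ⟨h1, h2, h3⟩ := ih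
    simp only [Function.iterate_succ_apply']
    exact ⟨irrational_subStep h1, subStep_pos h1 h2, by rw [h3, subStep_inv h1 h2]⟩

/-- `z > 1` is irrational and its partial quotients of index at least `N` are `1` or `2`. -/
def TailOnesAndTwos (N : ℕ) (z : ℝ) : Prop :=
  Irrational z ∧ 1 < z ∧ ∀ i ≥ N, cfTerm i z = 1 ∨ cfTerm i z = 2

theorem TailOnesAndTwos.inv_of_lt_one {N k : ℕ} {x : ℝ} (h : TailOnesAndTwos N (x + k))
    (h0 : 0 < x) (h1 : x < 1) : TailOnesAndTwos (N - 1) x⁻¹ := by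
  have hx : 1 < x⁻¹ := (one_lt_inv₀ h0).mpr h1
  refine ⟨(h.1.of_add_natCast k).inv, hx, fun i hi => ?_⟩
  rw [← cfTerm_succ_natCast_add_inv k hx, inv_inv, add_comm (k : ℝ)]
  exact h.2.2 (i + 1) (by omega)

theorem TailOnesAndTwos.lt_three {z : ℝ} (h : TailOnesAndTwos 0 z) : z < 3 := by
  have h1 : ⌊z⌋ ≤ 2 := by
    rcases h.2.2 0 le_rfl with h | h <;> rw [cfTerm] at h <;> omega
  have h2 : (⌊z⌋ : ℝ) ≤ 2 := by exact_mod_cast h1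
  linarith [Int.lt_floor_add_one z]

/-- `x` is a tail of the subtractive expansion of a number whose partial quotients are `1` or `2`,
and is preceded by at least `r` subtractions of the first kind or at least `l` of the second. -/
def HasRuns (r l : ℕ) (x : ℝ) : Prop :=
  (l = 0 ∧ ∃ k ≥ r, TailOnesAndTwos 0 (x + k)) ∨ (r = 0 ∧ ∃ k ≥ l, TailOnesAndTwos 0 (x⁻¹ + k))

theorem HasRuns.inv {r l : ℕ} {x : ℝ} (h : HasRuns r l x) : HasRuns l r x⁻¹ := by
  rcases h with h | h
  · right; simpa using h
  · left; exact h

theorem HasRuns.zero_zero {r l : ℕ} {x : ℝ} (h : HasRuns r l x) : HasRuns 0 0 x := by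
  rcases h with ⟨-, k, -, h⟩ | ⟨-, k, -, h⟩
  · exact .inl ⟨rfl, k, k.zero_le, h⟩
  · exact .inr ⟨rfl, k, k.zero_le, h⟩

theorem HasRuns.subStep_of_one_lt {r l : ℕ} {x : ℝ} (h : HasRuns r l x) (hx : 1 < x) :
    r ≤ 1 ∧ HasRuns (r + 1) 0 (subStep x) := by
  rw [_root_.subStep_of_one_lt hx]
  rcases h with ⟨-, k, hk, h⟩ | ⟨rfl, k, -, h⟩
  · have hk2 : k < 2 := by
      have := h.lt_three
      exact_mod_cast (by linarith : (k : ℝ) < 2)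
    refine ⟨by omega, .inl ⟨rfl, k + 1, by omega, ?_⟩⟩
    push_cast
    rwa [show x - 1 + (k + 1) = x + k by ring]
  · refine ⟨by omega, .inl ⟨rfl, 1, by omega, ?_⟩⟩
    have := h.inv_of_lt_one (by positivity) (inv_lt_one_of_one_lt₀ hx)
    simpa using this

theorem HasRuns.subStep_of_lt_one {r l : ℕ} {x : ℝ} (h : HasRuns r l x) (hi : Irrational x)
    (h0 : 0 < x) (hx : x < 1) : l ≤ 1 ∧ HasRuns 0 (l + 1) (subStep x) := by
  obtain ⟨h1, h2⟩ := h.inv.subStep_of_one_lt ((one_lt_inv₀ h0).mpr hx)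
  rw [subStep_inv hi h0] at h2
  exact ⟨h1, by simpa using h2.inv⟩

theorem HasRuns.iterate_subStep {x : ℝ} (h : HasRuns 0 0 x) (hi : Irrational x) (h0 : 0 < x)
    (n : ℕ) : HasRuns 0 0 (subStep^[n] x) := by
  induction n with
  | zero => exact h
  | succ n ih =>
    obtain ⟨h1, h2, -⟩ := iterate_subStep_spec hi h0 n
    rw [Function.iterate_succ_apply']
    rcases h1.lt_or_gt_one with hx | hx
    · exact (ih.subStep_of_lt_one h1 h2 hx).2.zero_zero
    · exact (ih.subStep_of_one_lt hx).2.zero_zero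

theorem TailOnesAndTwos.exists_iterate_subStep_inv {N : ℕ} (m : ℕ) {x : ℝ} {k : ℕ}
    (h : TailOnesAndTwos N (x + k)) (h0 : 0 < x) (hm : x < m) :
    ∃ n, TailOnesAndTwos (N - 1) (subStep^[n] x)⁻¹ := by
  induction m generalizing x k with
  | zero => norm_num at hm; linarith
  | succ m ih =>
    rcases (h.1.of_add_natCast k).lt_or_gt_one with hx | hx
    · exact ⟨0, h.inv_of_lt_one h0 hx⟩
    · push_cast at hm
      obtain ⟨n, hn⟩ := ih (x := x - 1) (k := k + 1)
        (by push_cast; rwa [show x - 1 + (k + 1) = x + k by ring]) (by linarith) (by linarith)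
      exact ⟨n + 1, by rwa [Function.iterate_succ_apply, subStep_of_one_lt hx]⟩

theorem TailOnesAndTwos.exists_hasRuns {N : ℕ} {x : ℝ} (h : TailOnesAndTwos N x) :
    ∃ n, HasRuns 0 0 (subStep^[n] x) := by
  induction N generalizing x with
  | zero => exact ⟨0, .inl ⟨rfl, 0, le_rfl, by simpa using h⟩⟩
  | succ N ih =>
    have h0 : 0 < x := one_pos.trans h.2.1
    obtain ⟨m, hm⟩ := exists_nat_gt x
    obtain ⟨n, hn⟩ :=
      TailOnesAndTwos.exists_iterate_subStep_inv (k := 0) m (by simpa using h) h0 hm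
    obtain ⟨n', hn'⟩ := ih hn
    obtain ⟨h1, h2, -⟩ := iterate_subStep_spec h.1 h0 n
    rw [(iterate_subStep_spec h1 h2 n').2.2] at hn'
    exact ⟨n' + n, by simpa [Function.iterate_add_apply] using hn'.inv⟩

theorem cfTerm_succ_add_intCast (i : ℕ) (x : ℝ) (n : ℤ) :
    cfTerm (i + 1) (x + n) = cfTerm (i + 1) x := by
  simp [cfTerm]

theorem EventuallyOnesAndTwos.exists_tailOnesAndTwos {x : ℝ} (h : EventuallyOnesAndTwos x)
    (n : ℤ) (hn : 1 < x + n) : ∃ N, TailOnesAndTwos N (x + n) := by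
  have hirr := h.irrational
  obtain ⟨N, hN⟩ := h
  refine ⟨N + 1, hirr.add_intCast n, hn, fun i hi => ?_⟩
  obtain ⟨k, rfl⟩ : ∃ k, i = k + 1 := ⟨i - 1, by omega⟩
  rw [cfTerm_succ_add_intCast]
  exact hN _ (by omega)

end SubtractiveExpansion

namespace NatMat

variable {M : NatMat} {p : ℕ} {x y : ℝ}

/-- The determinant of `M` is `p`. -/
def DetEq (M : NatMat) (p : ℕ) : Prop :=
  M.a * M.d = M.b * M.c + p

/-- Neither row of `M` dominates the other, so `M` does not determine the next output letter. -/
def IsRowBalanced (M : NatMat) : Prop :=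
  M.c < M.a ∧ M.b < M.d

theorem DetEq.pos_left (hM : M.DetEq p) (hp : 0 < p) : 0 < M.a := by
  rcases Nat.eq_zero_or_pos M.a with h | h
  · simp only [DetEq, h] at hM; omega
  · exact h

theorem DetEq.pos_right (hM : M.DetEq p) (hp : 0 < p) : 0 < M.d := by
  rcases Nat.eq_zero_or_pos M.d with h | h
  · simp only [DetEq, h] at hM; omega
  · exact h

/-- Read a letter of the first kind. -/
def inR (M : NatMat) : NatMat := ⟨M.a, M.a + M.b, M.c, M.c + M.d⟩

/-- Read a letter of the second kind. -/
def inL (M : NatMat) : NatMat := ⟨M.a + M.b, M.b, M.c + M.d, M.d⟩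

/-- Write a letter of the first kind. -/
def outR (M : NatMat) : NatMat := ⟨M.a - M.c, M.b - M.d, M.c, M.d⟩

/-- Write a letter of the second kind. -/
def outL (M : NatMat) : NatMat := ⟨M.a, M.b, M.c - M.a, M.d - M.b⟩

theorem DetEq.inR (hM : M.DetEq p) : M.inR.DetEq p := by
  simp only [DetEq, NatMat.inR] at hM ⊢; linarith

theorem DetEq.inL (hM : M.DetEq p) : M.inL.DetEq p := by
  simp only [DetEq, NatMat.inL] at hM ⊢; linarith

theorem DetEq.outR (hM : M.DetEq p) (h1 : M.c ≤ M.a) (h2 : M.d ≤ M.b) : M.outR.DetEq p := by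
  simp only [DetEq, NatMat.outR] at hM ⊢
  zify [h1, h2] at hM ⊢
  linarith

theorem DetEq.outL (hM : M.DetEq p) (h1 : M.a ≤ M.c) (h2 : M.b ≤ M.d) : M.outL.DetEq p := by
  simp only [DetEq, NatMat.outL] at hM ⊢
  zify [h1, h2] at hM ⊢
  linarith

theorem Rel.inR (h : M.Rel x y) (hx : 1 < x) : M.inR.Rel (subStep x) y := by
  rw [subStep_of_one_lt hx]
  simp only [Rel, NatMat.inR] at h ⊢
  push_cast
  linear_combination h

theorem Rel.inL (h : M.Rel x y) (h0 : 0 < x) (hx : x < 1) : M.inL.Rel (subStep x) y := by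
  have h1 : 1 - x ≠ 0 := by linarith
  rw [subStep_of_lt_one hx, show (x⁻¹ - 1)⁻¹ = x / (1 - x) by field_simp]
  simp only [Rel, NatMat.inL] at h ⊢
  push_cast
  field_simp
  linear_combination h

theorem DetEq.denom_pos (hM : M.DetEq p) (hp : 0 < p) (h0 : 0 < x) :
    0 < (M.c : ℝ) * x + M.d := by
  have : (0 : ℝ) < M.d := by exact_mod_cast hM.pos_right hp
  positivity

theorem Rel.outR (h : M.Rel x y) (hM : M.DetEq p) (hp : 0 < p) (h0 : 0 < x) (hy : Irrational y)
    (h1 : M.c ≤ M.a) (h2 : M.d ≤ M.b) : 1 < y ∧ M.outR.Rel x (subStep y) := by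
  have hden := hM.denom_pos hp h0
  have hy1 : 1 < y := by
    rcases hy.lt_or_gt_one with hlt | hgt
    · have h1' : (M.c : ℝ) ≤ M.a := by exact_mod_cast h1
      have h2' : (M.d : ℝ) ≤ M.b := by exact_mod_cast h2
      simp only [Rel] at h
      nlinarith [mul_le_mul_of_nonneg_right h1' h0.le]
    · exact hgt
  refine ⟨hy1, ?_⟩
  rw [subStep_of_one_lt hy1]
  simp only [Rel, NatMat.outR] at h ⊢
  push_cast [h1, h2]
  linear_combination h

theorem Rel.outL (h : M.Rel x y) (hM : M.DetEq p) (hp : 0 < p) (h0 : 0 < x) (hy : Irrational y)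
    (hy0 : 0 < y) (h1 : M.a ≤ M.c) (h2 : M.b ≤ M.d) : y < 1 ∧ M.outL.Rel x (subStep y) := by
  have hden := hM.denom_pos hp h0
  have hy1 : y < 1 := by
    rcases hy.lt_or_gt_one with hlt | hgt
    · exact hlt
    · have h1' : (M.a : ℝ) ≤ M.c := by exact_mod_cast h1
      have h2' : (M.b : ℝ) ≤ M.d := by exact_mod_cast h2
      simp only [Rel] at h
      nlinarith [mul_le_mul_of_nonneg_right h1' h0.le]
  refine ⟨hy1, ?_⟩
  have h1y : 1 - y ≠ 0 := by linarith
  rw [subStep_of_lt_one hy1, show (y⁻¹ - 1)⁻¹ = y / (1 - y) by field_simp]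
  simp only [Rel, NatMat.outL] at h ⊢
  push_cast [h1, h2]
  field_simp
  linear_combination h

theorem DetEq.trichotomy (hM : M.DetEq p) (hp : 0 < p) :
    (M.c ≤ M.a ∧ M.d ≤ M.b) ∨ (M.a ≤ M.c ∧ M.b ≤ M.d) ∨ M.IsRowBalanced := by
  by_contra! hcon
  obtain ⟨h1, h2, h3⟩ := hcon
  simp only [IsRowBalanced, DetEq] at *
  rcases lt_or_ge M.a M.c with h | h
  · have h4 := h2 h.le
    nlinarith [Nat.mul_le_mul h.le h4.le]
  · have h4 := h1 h
    rcases h.lt_or_eq with h5 | h5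
    · exact h3 ⟨h5, h4⟩
    · exact absurd (h2 h5.ge) (by omega)

theorem DetEq.exists_iterate_input (hM : M.DetEq p) (hxy : M.Rel x y) (hx : Irrational x)
    (h0 : 0 < x) (n : ℕ) : ∃ M' : NatMat, M'.DetEq p ∧ M'.Rel (subStep^[n] x) y := by
  induction n with
  | zero => exact ⟨M, hM, hxy⟩
  | succ n ih =>
    obtain ⟨M', hM', hxy'⟩ := ih
    obtain ⟨h1, h2, -⟩ := iterate_subStep_spec hx h0 n
    rw [Function.iterate_succ_apply']
    rcases h1.lt_or_gt_one with h | h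
    · exact ⟨_, hM'.inL, hxy'.inL h2 h⟩
    · exact ⟨_, hM'.inR, hxy'.inR h⟩

theorem DetEq.add_add_lt (hM : M.DetEq p) (h : M.IsRowBalanced) :
    M.b + M.c < p ∧ M.a + M.d ≤ p + 1 := by
  obtain ⟨a, b, c, d⟩ := M
  obtain ⟨h1, h2⟩ := h
  simp only [DetEq] at *
  obtain ⟨i, rfl⟩ := Nat.exists_eq_add_of_lt h1
  obtain ⟨e, rfl⟩ := Nat.exists_eq_add_of_lt h2
  constructor <;> nlinarith [Nat.zero_le (i * e), Nat.zero_le (c * e), Nat.zero_le (i * b)]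

theorem DetEq.exists_output (hM : M.DetEq p) (hp : 0 < p) (hxy : M.Rel x y) (hx : Irrational x)
    (h0 : 0 < x) (hy : Irrational y) (hy0 : 0 < y) :
    ∃ n, ∃ M' : NatMat, M'.DetEq p ∧ M'.Rel (subStep^[n] x) (subStep y) := by
  induction hk : 2 * p + 1 - (M.a + M.b + M.c + M.d) using Nat.strong_induction_on
    generalizing M x with
  | _ k ih =>
    rcases hM.trichotomy hp with h | h | h
    · exact ⟨0, _, hM.outR h.1 h.2, (hxy.outR hM hp h0 hy h.1 h.2).2⟩
    · exact ⟨0, _, hM.outL h.1 h.2, (hxy.outL hM hp h0 hy hy0 h.1 h.2).2⟩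
    · have hsum := hM.add_add_lt h
      have ha := hM.pos_left hp
      have hd := hM.pos_right hp
      have hx' := irrational_subStep hx
      have h0' := subStep_pos hx h0
      rcases hx.lt_or_gt_one with h1 | h1
      · obtain ⟨n, hn⟩ := ih _ (by simp only [NatMat.inL]; omega) hM.inL (hxy.inL h0 h1) hx' h0' rfl
        exact ⟨n + 1, hn⟩
      · obtain ⟨n, hn⟩ := ih _ (by simp only [NatMat.inR]; omega) hM.inR (hxy.inR h1) hx' h0' rfl
        exact ⟨n + 1, hn⟩

theorem DetEq.exists_iterate_output (hM : M.DetEq p) (hp : 0 < p) (hxy : M.Rel x y)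
    (hx : Irrational x) (h0 : 0 < x) (hy : Irrational y) (hy0 : 0 < y) (m : ℕ) :
    ∃ n, ∃ M' : NatMat, M'.DetEq p ∧ M'.Rel (subStep^[n] x) (subStep^[m] y) := by
  induction m with
  | zero => exact ⟨0, M, hM, hxy⟩
  | succ m ih =>
    obtain ⟨n, M', hM', hxy'⟩ := ih
    obtain ⟨h1, h2, -⟩ := iterate_subStep_spec hx h0 n
    obtain ⟨h3, h4, -⟩ := iterate_subStep_spec hy hy0 m
    obtain ⟨n', hn'⟩ := hM'.exists_output hp hxy' h1 h2 h3 h4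
    rw [← Function.iterate_add_apply, ← Function.iterate_succ_apply' subStep] at hn'
    exact ⟨_, hn'⟩

theorem DetEq.exists_isRowBalanced (hM : M.DetEq p) (hp : 0 < p) (hxy : M.Rel x y)
    (h0 : 0 < x) (hy : Irrational y) (hy0 : 0 < y) :
    ∃ n, ∃ M' : NatMat, M'.DetEq p ∧ M'.IsRowBalanced ∧ M'.Rel x (subStep^[n] y) := by
  induction hk : M.a + M.b + M.c + M.d using Nat.strong_induction_on generalizing M y with
  | _ k ih =>
    have ha := hM.pos_left hp
    have hd := hM.pos_right hp
    have hy' := irrational_subStep hy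
    have hy0' := subStep_pos hy hy0
    rcases hM.trichotomy hp with h | h | h
    · obtain ⟨n, hn⟩ := ih _ (by simp only [NatMat.outR]; omega) (hM.outR h.1 h.2)
        (hxy.outR hM hp h0 hy h.1 h.2).2 hy' hy0' rfl
      exact ⟨n + 1, hn⟩
    · obtain ⟨n, hn⟩ := ih _ (by simp only [NatMat.outL]; omega) (hM.outL h.1 h.2)
        (hxy.outL hM hp h0 hy hy0 h.1 h.2).2 hy' hy0' rfl
      exact ⟨n + 1, hn⟩
    · exact ⟨0, M, hM, h, hxy⟩

theorem alive_of_hasRuns (hM : M.DetEq p) (hp : 0 < p) (hxy : M.Rel x y)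
    (hx : Irrational x) (h0 : 0 < x) (hy : Irrational y) (hy0 : 0 < y) {xr xl yr yl : ℕ}
    (hrx : HasRuns xr xl x) (hry : HasRuns yr yl y) (k : ℕ) : alive k M xr xl yr yl = true := by
  induction k generalizing M x y xr xl yr yl with
  | zero => rfl
  | succ k ih =>
    have hx' := irrational_subStep hx
    have h0' := subStep_pos hx h0
    have hy' := irrational_subStep hy
    have hy0' := subStep_pos hy hy0
    rw [alive]
    by_cases hR : M.c ≤ M.a ∧ M.d ≤ M.b
    · obtain ⟨h1, h2⟩ := hxy.outR hM hp h0 hy hR.1 hR.2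
      obtain ⟨h3, h4⟩ := hry.subStep_of_one_lt h1
      have := ih (hM.outR hR.1 hR.2) h2 hx h0 hy' hy0' hrx h4
      simpa [hR, h3, outR] using this
    have hR' : (M.c.ble M.a && M.d.ble M.b) = false :=
      Bool.eq_false_iff.mpr fun h => hR (by simpa using h)
    by_cases hL : M.a ≤ M.c ∧ M.b ≤ M.d
    · obtain ⟨h1, h2⟩ := hxy.outL hM hp h0 hy hy0 hL.1 hL.2
      obtain ⟨h3, h4⟩ := hry.subStep_of_lt_one hy hy0 h1
      have := ih (hM.outL hL.1 hL.2) h2 hx h0 hy' hy0' hrx h4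
      simpa [hR', hL, h3, outL] using this
    have hL' : (M.a.ble M.c && M.b.ble M.d) = false :=
      Bool.eq_false_iff.mpr fun h => hL (by simpa using h)
    rw [hR', hL', cond_false, cond_false, Bool.or_eq_true]
    rcases hx.lt_or_gt_one with h | h
    · obtain ⟨h3, h4⟩ := hrx.subStep_of_lt_one hx h0 h
      have := ih hM.inL (hxy.inL h0 h) hx' h0' hy hy0 h4 hry
      exact .inr (by simpa [h3, inL] using this)
    · obtain ⟨h3, h4⟩ := hrx.subStep_of_one_lt h
      have := ih hM.inR (hxy.inR h) hx' h0' hy hy0 h4 hry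
      exact .inl (by simpa [h3, inR] using this)

end NatMat

theorem not_exists_sixtySeven :
    ¬ ∃ ξ : ℝ, Irrational ξ ∧ EventuallyOnesAndTwos ξ ∧ EventuallyOnesAndTwos (67 * ξ) := by
  rintro ⟨ξ, -, hξ, hη⟩
  obtain ⟨n, hn⟩ : ∃ n : ℤ, 1 < ξ + n :=
    ⟨2 - ⌊ξ⌋, by push_cast; linarith [Int.floor_le ξ]⟩
  have hmul : 67 * ξ + (67 * n : ℤ) = 67 * (ξ + n) := by push_cast; ring
  obtain ⟨N₁, h₁⟩ := hξ.exists_tailOnesAndTwos n hn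
  obtain ⟨N₂, h₂⟩ := hη.exists_tailOnesAndTwos (67 * n) (by rw [hmul]; linarith)
  rw [hmul] at h₂
  set x := ξ + n
  have hx0 : 0 < x := by linarith
  have hy0 : 0 < 67 * x := by linarith
  obtain ⟨k₁, hk₁⟩ := h₁.exists_hasRuns
  obtain ⟨k₂, hk₂⟩ := h₂.exists_hasRuns
  obtain ⟨hx₁, hx₁0, -⟩ := iterate_subStep_spec h₁.1 hx0 k₁
  have hdet : NatMat.DetEq ⟨67, 0, 0, 1⟩ 67 := by simp [NatMat.DetEq]
  have hrel : NatMat.Rel ⟨67, 0, 0, 1⟩ x (67 * x) := by simp [NatMat.Rel]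
  obtain ⟨M₁, hM₁, hxy₁⟩ := hdet.exists_iterate_input hrel h₁.1 hx0 k₁
  obtain ⟨m, M₂, hM₂, hxy₂⟩ :=
    hM₁.exists_iterate_output (by norm_num) hxy₁ hx₁ hx₁0 h₂.1 hy0 k₂
  obtain ⟨hx₂, hx₂0, -⟩ := iterate_subStep_spec hx₁ hx₁0 m
  obtain ⟨hy₂, hy₂0, -⟩ := iterate_subStep_spec h₂.1 hy0 k₂
  obtain ⟨l, M, hM, hbal, hxy⟩ := hM₂.exists_isRowBalanced (by norm_num) hxy₂ hx₂0 hy₂ hy₂0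
  obtain ⟨hy₃, hy₃0, -⟩ := iterate_subStep_spec hy₂ hy₂0 l
  have halive := NatMat.alive_of_hasRuns hM (by norm_num) hxy hx₂ hx₂0 hy₃ hy₃0
    (hk₁.iterate_subStep hx₁ hx₁0 m) (hk₂.iterate_subStep hy₂ hy₂0 l) 50
  have hsum := hM.add_add_lt hbal
  obtain ⟨a, b, c, d⟩ := M
  obtain ⟨hca, hbd⟩ := hbal
  simp only [NatMat.DetEq] at *
  obtain ⟨i, rfl⟩ : ∃ i, a = c + 1 + i := ⟨a - (c + 1), by omega⟩
  have hprod : 67 + b * c = (c + 1 + i) * d := by omega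
  have hdead := not_alive_sixtySeven (b := b) (c := c) (i := i) (by omega) (by omega) (by omega)
    (by rw [hprod, Nat.mul_mod_right])
  rw [hprod, Nat.mul_div_cancel_left d (by omega), halive] at hdead
  exact absurd hdead (by simp)

theorem stmt_1 (p : ℕ) (hp : Nat.Prime p) (hlt : p < 2000) :
    (¬ ∃ ξ : ℝ, Irrational ξ ∧ EventuallyOnesAndTwos ξ ∧
        EventuallyOnesAndTwos ((p : ℝ) * ξ)) ↔ p = 67 := by
  constructor
  · intro h
    by_contra h67
    obtain ⟨t, ht, rfl⟩ := exists_mem_witnessTable hp hlt h67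
    exact h (isWitness_of_mem_witnessTable t ht).exists_irrational
  · rintro rfl
    exact_mod_cast not_exists_sixtySeven
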